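/- arXiv:2307.01034 — 2 statements merged into one kernel-verified Lean document; each statement's English description precedes it below -/
import Mathlib

section
/- Let ((c̄,b̄),x̄) ∈ gph F^op. Then clm F^op((c̄,b̄),x̄) = clm F_c̄^op(b̄,x̄) = max_{D ∈ M_{c̄,b̄}} clm L_D((b̄,−b̄_D),x̄) = ( min_{D ∈ M_{c̄,b̄}} d_*(0_n, end conv{a_t, t ∈ T_b̄(x̄); −a_t, t ∈ D}) )^{-1}. -/
open scoped ENNReal RealInnerProductSpace
open Filter EMetric Set

/-- Calmness modulus of a set-valued mapping `M` at `(ybar, xbar)`: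
`limsup_{x → xbar} d(x, M(ybar)) / d(ybar, M⁻¹(x))`, with conventions `0/0 = 0`
and `d(·, ∅) = ∞` (automatic in `ℝ≥0∞`). -/
noncomputable def clmMod {Y X : Type*} [PseudoEMetricSpace Y] [PseudoEMetricSpace X]
    (M : Y → Set X) (ybar : Y) (xbar : X) : ℝ≥0∞ :=
  Filter.limsup
    (fun x => EMetric.infEdist x (M ybar) / EMetric.infEdist ybar {y | x ∈ M y}) (nhds xbar)

/-- Lipschitz upper semicontinuity modulus of `M` at `ybar`:
`limsup_{y → ybar} sup_{x ∈ M(y)} d(x, M(ybar)) / d(y, ybar)`. -/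
noncomputable def lipuscMod {Y X : Type*} [PseudoEMetricSpace Y] [PseudoEMetricSpace X]
    (M : Y → Set X) (ybar : Y) : ℝ≥0∞ :=
  Filter.limsup
    (fun y => ⨆ x ∈ M y, EMetric.infEdist x (M ybar) / edist y ybar) (nhds ybar)

/-- Hoffman constant of `M`: `sup_{(y,x) ∈ dom M × X} d(x, M(y)) / d(y, M⁻¹(x))`. -/
noncomputable def hofConst {Y X : Type*} [PseudoEMetricSpace Y] [PseudoEMetricSpace X]
    (M : Y → Set X) : ℝ≥0∞ :=
  ⨆ y ∈ {y | (M y).Nonempty}, ⨆ x : X,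
    EMetric.infEdist x (M y) / EMetric.infEdist y {y' | x ∈ M y'}

/-- The feasible set mapping `F(b) = {x ∈ ℝⁿ : ⟨a_t, x⟩ ≤ b_t for all t ∈ T}`. -/
def Feas {n m : ℕ} (a : Fin m → EuclideanSpace ℝ (Fin n)) (b : Fin m → ℝ) :
    Set (EuclideanSpace ℝ (Fin n)) :=
  {x | ∀ t, ⟪a t, x⟫ ≤ b t}

/-- The optimal set (argmin) mapping `F^op(c,b) = argmin{⟨c,x⟩ : x ∈ F(b)}`. -/
def Fop {n m : ℕ} (a : Fin m → EuclideanSpace ℝ (Fin n)) (c : EuclideanSpace ℝ (Fin n))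
    (b : Fin m → ℝ) : Set (EuclideanSpace ℝ (Fin n)) :=
  {x | x ∈ Feas a b ∧ ∀ y ∈ Feas a b, ⟪c, x⟫ ≤ ⟪c, y⟫}

/-- Active index set `T_b(x) = {t ∈ T : ⟨a_t, x⟩ = b_t}`. -/
def activeSet {n m : ℕ} (a : Fin m → EuclideanSpace ℝ (Fin n)) (b : Fin m → ℝ)
    (x : EuclideanSpace ℝ (Fin n)) : Set (Fin m) :=
  {t | ⟪a t, x⟫ = b t}

/-- `z ∈ cone{a_t : t ∈ D}` (conical convex hull). -/
def InCone {n m : ℕ} (a : Fin m → EuclideanSpace ℝ (Fin n)) (D : Finset (Fin m))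
    (z : EuclideanSpace ℝ (Fin n)) : Prop :=
  ∃ lam : Fin m → ℝ, (∀ t, 0 ≤ lam t) ∧ (∀ t ∉ D, lam t = 0) ∧ z = ∑ t, lam t • a t

/-- The family of minimal KKT index subsets `M_{c,b}`: all `D ⊆ T_b(x)` (for an optimal
point `x ∈ F^op(c,b)`; independent of the choice of `x`) with `−c ∈ cone{a_t : t ∈ D}`,
minimal with respect to inclusion among such subsets. (It is empty when `F^op(c,b) = ∅`.) -/
def Mcb {n m : ℕ} (a : Fin m → EuclideanSpace ℝ (Fin n)) (c : EuclideanSpace ℝ (Fin n))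
    (b : Fin m → ℝ) : Set (Finset (Fin m)) :=
  {D | ∃ x ∈ Fop a c b, (D : Set (Fin m)) ⊆ activeSet a b x ∧ InCone a D (-c) ∧
    ∀ D' ⊆ D, InCone a D' (-c) → D' = D}

/-- `L_D(b,d) = {x : ⟨a_t,x⟩ ≤ b_t, t ∈ T; −⟨a_t,x⟩ ≤ d_t, t ∈ D}`. -/
def LD {n m : ℕ} (a : Fin m → EuclideanSpace ℝ (Fin n)) (D : Finset (Fin m))
    (b d : Fin m → ℝ) : Set (EuclideanSpace ℝ (Fin n)) :=
  {x | (∀ t, ⟪a t, x⟫ ≤ b t) ∧ ∀ t ∈ D, -⟪a t, x⟫ ≤ d t}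

/-- End set of a convex set `C`: `end C = {u ∈ cl C : ¬∃ μ > 1, μ • u ∈ cl C}`. -/
def endSet {E : Type*} [NormedAddCommGroup E] [NormedSpace ℝ E] (C : Set E) : Set E :=
  {u ∈ closure C | ¬ ∃ μ : ℝ, 1 < μ ∧ μ • u ∈ closure C}

section Cone

variable {E : Type*} [NormedAddCommGroup E] [InnerProductSpace ℝ E] {ι : Type*}

/-- The conical hull of a finite family of vectors. -/
def finCone [Fintype ι] (g : ι → E) : Set E :=
  {z | ∃ lam : ι → ℝ, (∀ i, 0 ≤ lam i) ∧ z = ∑ i, lam i • g i}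

/-- Carathéodory's theorem for cones. -/
theorem exists_linearIndepOn_conic_combination (g : ι → E) (s : Finset ι) (lam : ι → ℝ)
    (hlam : ∀ i, 0 ≤ lam i) :
    ∃ s' ⊆ s, LinearIndepOn ℝ g (s' : Set ι) ∧
      ∃ nu : ι → ℝ, (∀ i, 0 ≤ nu i) ∧ ∑ i ∈ s, lam i • g i = ∑ i ∈ s', nu i • g i := by
  classical
  induction s using Finset.strongInduction generalizing lam with
  | H s ih =>
    by_cases hs : LinearIndepOn ℝ g (s : Set ι)
    · exact ⟨s, subset_rfl, hs, lam, hlam, rfl⟩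
    have key : ∃ c : ι → ℝ, ∑ i ∈ s, c i • g i = 0 ∧ ∃ i ∈ s, 0 < c i := by
      rw [linearIndepOn_finset_iff] at hs
      push Not at hs
      obtain ⟨c, hc, i, his, hi⟩ := hs
      rcases lt_or_gt_of_ne hi with h | h
      · exact ⟨-c, by simp [hc], i, his, by simpa using h⟩
      · exact ⟨c, hc, i, his, h⟩
    obtain ⟨c, hc, i₀, hi₀s, hi₀⟩ := key
    obtain ⟨j, hj, hmin⟩ := Finset.exists_min_image (s.filter fun i => 0 < c i)
      (fun i => lam i / c i) ⟨i₀, by simp [hi₀s, hi₀]⟩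
    rw [Finset.mem_filter] at hj
    set θ := lam j / c j with hθ
    have hθ0 : 0 ≤ θ := div_nonneg (hlam j) hj.2.le
    have hnn : ∀ i ∈ s, 0 ≤ lam i - θ * c i := by
      intro i hi
      rcases lt_or_ge 0 (c i) with h | h
      · have := hmin i (by simp [hi, h])
        rw [le_div_iff₀ h] at this
        linarith
      · nlinarith [hlam i]
    have hj0 : lam j - θ * c j = 0 := by
      rw [hθ, div_mul_cancel₀ _ hj.2.ne', sub_self]
    obtain ⟨s', hs', hli, nu, hnu, heq⟩ := ih (s.erase j) (Finset.erase_ssubset hj.1)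
      (fun i => max 0 (lam i - θ * c i)) (fun i => le_max_left _ _)
    refine ⟨s', hs'.trans (Finset.erase_subset _ _), hli, nu, hnu, heq ▸ ?_⟩
    have h1 : ∑ i ∈ s, lam i • g i = ∑ i ∈ s, (lam i - θ * c i) • g i := by
      simp only [sub_smul, Finset.sum_sub_distrib, mul_smul, ← Finset.smul_sum, hc]
      simp
    rw [h1, ← Finset.add_sum_erase s _ hj.1, hj0, zero_smul, zero_add]
    refine Finset.sum_congr rfl fun i hi => ?_
    rw [max_eq_right (hnn i (Finset.mem_of_mem_erase hi))]

theorem isClosed_finCone [Fintype ι] (g : ι → E) : IsClosed (finCone g) := by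
  classical
  have h : finCone g = ⋃ s ∈ {s : Finset ι | LinearIndepOn ℝ g (s : Set ι)},
      (Fintype.linearCombination ℝ fun i : (s : Set ι) => g i) '' Ici 0 := by
    ext z
    simp only [mem_iUnion, mem_image, exists_prop, mem_ofPred_eq]
    constructor
    · rintro ⟨lam, hlam, rfl⟩
      obtain ⟨s, -, hli, nu, hnu, heq⟩ :=
        exists_linearIndepOn_conic_combination g Finset.univ lam hlam
      refine ⟨s, hli, fun i => nu i, fun i => hnu i, ?_⟩
      rw [heq, Fintype.linearCombination_apply]
      exact Finset.sum_coe_sort s fun i => nu i • g i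
    · rintro ⟨s, -, c, hc, rfl⟩
      refine ⟨fun i => if h : i ∈ s then c ⟨i, h⟩ else 0, fun i => ?_, ?_⟩
      · dsimp only
        split_ifs with h
        · exact hc _
        · exact le_rfl
      · rw [Fintype.linearCombination_apply]
        have : ∑ i, (if h : i ∈ s then c ⟨i, h⟩ else 0) • g i
            = ∑ i ∈ s, (if h : i ∈ s then c ⟨i, h⟩ else 0) • g i := by
          refine (Finset.sum_subset (Finset.subset_univ s) fun i _ hi => ?_).symm
          simp [hi]
        rw [this, ← Finset.sum_coe_sort s]
        refine Finset.sum_congr rfl fun i _ => ?_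
        rw [dif_pos (Finset.mem_coe.1 i.2)]
  rw [h]
  refine (Set.toFinite _).isClosed_biUnion fun s hs => ?_
  have hinj : LinearMap.ker (Fintype.linearCombination ℝ fun i : (s : Set ι) => g i) = ⊥ := by
    rw [LinearMap.ker_eq_bot]
    exact linearIndependent_iff_injective_fintypeLinearCombination.1 hs
  exact (LinearMap.isClosedEmbedding_of_injective hinj).isClosedMap _ isClosed_Ici

/-- Farkas' lemma for a finite family of vectors. -/
theorem mem_finCone_of_forall_inner_le [FiniteDimensional ℝ E] [Fintype ι] (g : ι → E) (z : E)
    (hz : ∀ w, (∀ i, ⟪g i, w⟫ ≤ 0) → ⟪z, w⟫ ≤ 0) : z ∈ finCone g := by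
  classical
  by_contra hmem
  let C : ProperCone ℝ E :=
    { carrier := finCone g
      add_mem' := by
        rintro x y ⟨l, hl, rfl⟩ ⟨k, hk, rfl⟩
        exact ⟨l + k, fun i => add_nonneg (hl i) (hk i), by
          simp [add_smul, Finset.sum_add_distrib]⟩
      zero_mem' := ⟨0, fun _ => le_rfl, by simp⟩
      smul_mem' := by
        rintro r x ⟨l, hl, rfl⟩
        refine ⟨fun i => r * l i, fun i => mul_nonneg r.2 (hl i), ?_⟩
        simp [Finset.smul_sum, mul_smul]
      isClosed' := isClosed_finCone g }
  have : CompleteSpace E := FiniteDimensional.complete ℝ E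
  obtain ⟨y, hy, hzy⟩ := ProperCone.hyperplane_separation' C (x₀ := z) hmem
  have h := hz (-y) fun i => by
    have hi : g i ∈ C := ⟨Pi.single i 1, fun j => by
      by_cases h : j = i
      · subst h; simp
      · simp [h], by simp [Pi.single_apply, ite_smul]⟩
    have := hy _ hi
    rw [inner_neg_right]
    linarith
  rw [inner_neg_right] at h
  linarith

end Cone

section EndSet

variable {E : Type*} [NormedAddCommGroup E] [InnerProductSpace ℝ E] {G : Set E}

/-- Elements of the convex hull inherit upper bounds on their pairing with a fixed vector. -/
theorem inner_le_of_mem_convexHull {u w : E} {c : ℝ} (hu : u ∈ convexHull ℝ G)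
    (h : ∀ v ∈ G, ⟪v, w⟫ ≤ c) : ⟪u, w⟫ ≤ c := by
  have hconv : Convex ℝ {v : E | ⟪v, w⟫ ≤ c} := by
    intro x hx y hy p q hp hq hpq
    simp only [mem_ofPred_eq, inner_add_left, real_inner_smul_left] at *
    calc p * ⟪x, w⟫ + q * ⟪y, w⟫ ≤ p * c + q * c := by gcongr
      _ = c := by rw [← add_mul, hpq, one_mul]
  exact convexHull_min h hconv hu

/-- A nonzero conic combination of vectors of `G` is a positive multiple of an end point of the
convex hull of `G`. -/
theorem exists_mem_endSet_smul_eq (hG : G.Finite) [Fintype G] {v : E} (hv : v ≠ 0)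
    (hvc : v ∈ finCone fun g : G => (g : E)) :
    ∃ u ∈ endSet (convexHull ℝ G), ∃ r : ℝ, 0 < r ∧ v = r • u := by
  obtain ⟨lam, hlam, hsum⟩ := hvc
  set S := ∑ i, lam i with hS
  have hS0 : 0 < S := by
    refine lt_of_le_of_ne (Finset.sum_nonneg fun i _ => hlam i) fun h => hv ?_
    have := (Finset.sum_eq_zero_iff_of_nonneg fun i _ => hlam i).1 h.symm
    rw [hsum]
    exact Finset.sum_eq_zero fun i hi => by rw [this i hi, zero_smul]
  have hmem : S⁻¹ • v ∈ convexHull ℝ G := by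
    have : S⁻¹ • v = ∑ i, (S⁻¹ * lam i) • (i : E) := by
      rw [hsum, Finset.smul_sum]
      simp only [mul_smul]
    rw [this]
    refine (convex_convexHull ℝ G).sum_mem
      (fun i _ => mul_nonneg (inv_nonneg.2 hS0.le) (hlam i)) ?_
      fun i _ => subset_convexHull ℝ G i.2
    rw [← Finset.mul_sum, ← hS, inv_mul_cancel₀ hS0.ne']
  have hcpt : IsCompact (convexHull ℝ G) := hG.isCompact_convexHull ℝ
  have hclosed : IsClosed (convexHull ℝ G) := hcpt.isClosed
  set A : Set ℝ := {t : ℝ | 0 ≤ t ∧ t • v ∈ convexHull ℝ G} with hA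
  have hAclosed : IsClosed A :=
    (isClosed_le continuous_const continuous_id).inter
      (hclosed.preimage (continuous_id.smul continuous_const))
  obtain ⟨R, hR⟩ := hcpt.isBounded.exists_norm_le
  have hAbdd : A ⊆ Icc 0 (R / ‖v‖) := by
    rintro t ⟨ht0, ht⟩
    refine ⟨ht0, ?_⟩
    have := hR _ ht
    rw [norm_smul, Real.norm_of_nonneg ht0] at this
    rwa [le_div_iff₀ (norm_pos_iff.2 hv)]
  have hAcpt : IsCompact A := isCompact_Icc.of_isClosed_subset hAclosed hAbdd
  obtain ⟨t, ht, htmax⟩ := hAcpt.exists_isMaxOn ⟨S⁻¹, inv_nonneg.2 hS0.le, hmem⟩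
    continuousOn_id
  have ht0 : 0 < t :=
    (inv_pos.2 hS0).trans_le (htmax (a := S⁻¹) ⟨inv_nonneg.2 hS0.le, hmem⟩)
  refine ⟨t • v, ⟨subset_closure ht.2, ?_⟩, t⁻¹, inv_pos.2 ht0, ?_⟩
  · rintro ⟨μ, hμ, hμv⟩
    rw [hclosed.closure_eq, smul_smul] at hμv
    have : μ * t ≤ t := htmax (a := μ * t) ⟨by positivity, hμv⟩
    nlinarith
  · rw [smul_smul, inv_mul_cancel₀ ht0.ne', one_smul]

/-- Projection onto the polyhedral cone polar to a finite set `G`, with the resulting error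
bound. -/
theorem exists_polar_point [FiniteDimensional ℝ E] (hG : G.Finite) (x : E) {ε : ℝ}
    (hx : ∀ v ∈ G, ⟪v, x⟫ ≤ ε) :
    ∃ p : E, (∀ v ∈ G, ⟪v, p⟫ ≤ 0) ∧ ‖p‖ ≤ ‖x‖ ∧
      (x = p ∨ ∃ u ∈ endSet (convexHull ℝ G), 0 < ‖u‖ ∧ ‖x - p‖ ≤ ‖u‖⁻¹ * ε) := by
  have : CompleteSpace E := FiniteDimensional.complete ℝ E
  have : Fintype G := hG.fintype
  set K : Set E := {w | ∀ v ∈ G, ⟪v, w⟫ ≤ 0} with hK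
  have hKconv : Convex ℝ K := by
    intro y hy z hz p q hp hq _ v hv
    rw [inner_add_right, real_inner_smul_right, real_inner_smul_right]
    have := mul_nonneg hp (neg_nonneg.2 (hy v hv))
    have := mul_nonneg hq (neg_nonneg.2 (hz v hv))
    linarith
  have hKclosed : IsClosed K := by
    have : K = ⋂ v ∈ G, {w | ⟪v, w⟫ ≤ 0} := by ext; simp [hK]
    rw [this]
    exact isClosed_biInter fun v _ => isClosed_le (by fun_prop) continuous_const
  have h0K : (0 : E) ∈ K := fun v _ => by simp
  obtain ⟨p, hpK, hp⟩ :=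
    exists_norm_eq_iInf_of_complete_convex ⟨0, h0K⟩ hKclosed.isComplete hKconv x
  rw [norm_eq_iInf_iff_real_inner_le_zero hKconv hpK] at hp
  have hpp : ⟪x - p, p⟫ = 0 := by
    have h1 := hp 0 h0K
    have h2 := hp ((2 : ℝ) • p) fun v hv => by
      rw [real_inner_smul_right]
      linarith [hpK v hv]
    rw [zero_sub, inner_neg_right] at h1
    rw [two_smul, add_sub_cancel_right] at h2
    linarith
  have hpol : ∀ w ∈ K, ⟪x - p, w⟫ ≤ 0 := fun w hw => by
    have := hp w hw
    rw [inner_sub_right, hpp] at this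
    linarith
  refine ⟨p, hpK, ?_, ?_⟩
  · have h1 : ‖p‖ * ‖p‖ ≤ ‖x‖ * ‖p‖ := by
      rw [← real_inner_self_eq_norm_mul_norm]
      rw [inner_sub_left] at hpp
      linarith [real_inner_le_norm x p]
    rcases (norm_nonneg p).eq_or_lt with h | h
    · rw [← h]
      exact norm_nonneg x
    · exact le_of_mul_le_mul_right h1 h
  · by_cases hxp : x = p
    · exact Or.inl hxp
    right
    have hv : x - p ≠ 0 := sub_ne_zero.2 hxp
    have hcone : x - p ∈ finCone fun g : G => (g : E) :=
      mem_finCone_of_forall_inner_le _ _ fun w hw => hpol w fun v hvG => hw ⟨v, hvG⟩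
    obtain ⟨u, hu, r, hr, hru⟩ := exists_mem_endSet_smul_eq hG hv hcone
    have hu0 : 0 < ‖u‖ := norm_pos_iff.2 fun h => hv (by rw [hru, h, smul_zero])
    refine ⟨u, hu, hu0, ?_⟩
    have huC : u ∈ convexHull ℝ G := by
      have := hu.1
      rwa [(hG.isClosed_convexHull ℝ).closure_eq] at this
    have h1 : ⟪u, x⟫ ≤ ε := inner_le_of_mem_convexHull huC hx
    have h2 : ⟪u, p⟫ = 0 := by
      rw [hru, real_inner_smul_left] at hpp
      exact (mul_eq_zero.1 hpp).resolve_left hr.ne'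
    have h3 : ‖u‖ * ‖x - p‖ = ⟪u, x⟫ := by
      have : ⟪u, x - p⟫ = ‖u‖ * ‖x - p‖ := by
        rw [hru, real_inner_smul_right, norm_smul, Real.norm_of_nonneg hr.le,
          real_inner_self_eq_norm_mul_norm]
        ring
      rw [← this, inner_sub_right, h2, sub_zero]
    rw [inv_mul_eq_div, le_div_iff₀ hu0]
    linarith

/-- An end point of the convex hull of `G` is almost exposed by a direction on which the support
function is positive. -/
theorem exists_direction_of_mem_endSet [CompleteSpace E] {u : E}
    (hu : u ∈ endSet (convexHull ℝ G)) {μ : ℝ} (hμ : 1 < μ) :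
    ∃ (w : E) (c : ℝ), 0 < c ∧ (∀ v ∈ G, ⟪v, w⟫ ≤ c) ∧ c < μ * ⟪u, w⟫ := by
  obtain ⟨f, c, hf, hc⟩ := geometric_hahn_banach_closed_point (convex_convexHull ℝ G).closure
    isClosed_closure (fun h => hu.2 ⟨μ, hμ, h⟩)
  set w := (InnerProductSpace.toDual ℝ E).symm f with hw
  have hfw : ∀ v, f v = ⟪v, w⟫ := fun v => by
    rw [real_inner_comm, hw, InnerProductSpace.toDual_symm_apply]
  have h1 : ⟪u, w⟫ < c := hfw u ▸ hf u hu.1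
  have h2 : c < μ * ⟪u, w⟫ := by
    rw [hfw, real_inner_smul_left] at hc
    exact hc
  refine ⟨w, c, ?_, fun v hv => ?_, h2⟩
  · by_contra h
    nlinarith
  · rw [← hfw]
    exact (hf v (subset_closure (subset_convexHull ℝ G hv))).le

end EndSet

section LinearProgram

variable {n m : ℕ} {a : Fin m → EuclideanSpace ℝ (Fin n)} {c x y z : EuclideanSpace ℝ (Fin n)}
  {b : Fin m → ℝ} {D : Finset (Fin m)}

/-- Sufficiency of the Karush-Kuhn-Tucker conditions. -/
theorem mem_Fop_of_inCone (hx : x ∈ Feas a b) (hD : (D : Set (Fin m)) ⊆ activeSet a b x)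
    (hc : InCone a D (-c)) : x ∈ Fop a c b := by
  refine ⟨hx, fun y hy => ?_⟩
  obtain ⟨lam, hlam, hlam0, hsum⟩ := hc
  have h : ⟪-c, y⟫ ≤ ⟪-c, x⟫ := by
    simp only [hsum, sum_inner, real_inner_smul_left]
    refine Finset.sum_le_sum fun t _ => ?_
    by_cases ht : t ∈ D
    · have hact : ⟪a t, x⟫ = b t := hD ht
      rw [hact]
      exact mul_le_mul_of_nonneg_left (hy t) (hlam t)
    · simp [hlam0 t ht]
  simp only [inner_neg_left] at h
  linarith

/-- Strictly satisfied constraints remain strictly satisfied nearby. -/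
theorem eventually_inactive (a : Fin m → EuclideanSpace ℝ (Fin n)) (b : Fin m → ℝ)
    (x : EuclideanSpace ℝ (Fin n)) :
    ∀ᶠ w in nhds x, ∀ t, ⟪a t, x⟫ < b t → ⟪a t, w⟫ < b t := by
  rw [eventually_all]
  intro t
  by_cases h : ⟪a t, x⟫ < b t
  · have : ContinuousAt (fun w => ⟪a t, w⟫) x := by fun_prop
    filter_upwards [this.eventually_lt continuousAt_const h] with w hw _ using hw
  · exact Eventually.of_forall fun w hw => absurd hw h

/-- Necessity of the Karush-Kuhn-Tucker conditions. -/
theorem exists_inCone_of_mem_Fop (hx : x ∈ Fop a c b) :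
    ∃ D : Finset (Fin m), (D : Set (Fin m)) ⊆ activeSet a b x ∧ InCone a D (-c) := by
  classical
  let D : Finset (Fin m) := Finset.univ.filter fun t => ⟪a t, x⟫ = b t
  refine ⟨D, fun t ht => by simpa [D, activeSet] using ht, ?_⟩
  have key : -c ∈ finCone fun t : D => a t := by
    refine mem_finCone_of_forall_inner_le _ _ fun w hw => ?_
    have htend : Tendsto (fun τ : ℝ => x + τ • w) (nhdsWithin 0 (Ioi 0)) (nhds x) := by
      have : ContinuousAt (fun τ : ℝ => x + τ • w) 0 := by fun_prop
      simpa [ContinuousAt] using this.tendsto.mono_left nhdsWithin_le_nhds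
    obtain ⟨τ, hτ, hτ0⟩ :=
      ((htend.eventually (eventually_inactive a b x)).and self_mem_nhdsWithin).exists
    have hτ0 : 0 < τ := hτ0
    have hfeas : x + τ • w ∈ Feas a b := fun t => by
      by_cases ht : ⟪a t, x⟫ = b t
      · have h1 : ⟪a t, w⟫ ≤ 0 := hw ⟨t, by simp [D, ht]⟩
        rw [inner_add_right, real_inner_smul_right, ht]
        nlinarith
      · exact (hτ t (lt_of_le_of_ne (hx.1 t) ht)).le
    have h2 := hx.2 _ hfeas
    rw [inner_add_right, real_inner_smul_right] at h2
    rw [inner_neg_left]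
    have : 0 ≤ ⟪c, w⟫ := by
      by_contra h
      nlinarith
    linarith
  obtain ⟨lam, hlam, hsum⟩ := key
  refine ⟨fun t => if h : t ∈ D then lam ⟨t, h⟩ else 0, fun t => ?_, fun t ht => by simp [ht], ?_⟩
  · dsimp only
    split_ifs with h
    · exact hlam _
    · exact le_rfl
  · have : ∑ t, (if h : t ∈ D then lam ⟨t, h⟩ else 0) • a t
        = ∑ t ∈ D, (if h : t ∈ D then lam ⟨t, h⟩ else 0) • a t := by
      refine (Finset.sum_subset (Finset.subset_univ D) fun t _ ht => ?_).symm
      simp [ht]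
    rw [this, hsum, ← Finset.sum_coe_sort D]
    exact Finset.sum_congr rfl fun t _ => by rw [dif_pos t.2]

theorem exists_minimal_inCone (h : InCone a D z) :
    ∃ D' ⊆ D, InCone a D' z ∧ ∀ D'' ⊆ D', InCone a D'' z → D'' = D' := by
  obtain ⟨D', hle, hmin⟩ := exists_minimal_le_of_wellFoundedLT (fun D => InCone a D z) D h
  exact ⟨D', hle, hmin.1, fun D'' hsub hD'' => hmin.eq_of_le hD'' hsub⟩

/-- Multipliers supported on a minimal index set are positive there. -/
theorem exists_pos_of_minimal_inCone (h : InCone a D z)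
    (hmin : ∀ D' ⊆ D, InCone a D' z → D' = D) :
    ∃ lam : Fin m → ℝ, (∀ t, 0 ≤ lam t) ∧ (∀ t ∈ D, 0 < lam t) ∧ (∀ t ∉ D, lam t = 0) ∧
      z = ∑ t, lam t • a t := by
  classical
  obtain ⟨lam, hlam, hlam0, hsum⟩ := h
  refine ⟨lam, hlam, fun t ht => lt_of_le_of_ne (hlam t) fun h0 => ?_, hlam0, hsum⟩
  have h1 : InCone a (D.erase t) z := by
    refine ⟨lam, hlam, fun s hs => ?_, hsum⟩
    by_cases hst : s = t
    · rw [hst, ← h0]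
    · exact hlam0 s fun hsD => hs (Finset.mem_erase.2 ⟨hst, hsD⟩)
  have h2 := hmin _ (Finset.erase_subset t D) h1
  rw [← h2] at ht
  exact Finset.notMem_erase t D ht

/-- A minimal KKT index set is active at every optimal point. -/
theorem subset_activeSet_of_mem_Mcb (hD : D ∈ Mcb a c b) (hx : x ∈ Fop a c b) :
    (D : Set (Fin m)) ⊆ activeSet a b x := by
  obtain ⟨y, hy, hact, hcone, hmin⟩ := hD
  obtain ⟨lam, hlam, hpos, hlam0, hsum⟩ := exists_pos_of_minimal_inCone hcone hmin
  have hval : ⟪-c, x⟫ = ⟪-c, y⟫ := by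
    rw [inner_neg_left, inner_neg_left, le_antisymm (hx.2 y hy.1) (hy.2 x hx.1)]
  have hterm : ∀ t ∈ Finset.univ, 0 ≤ lam t * (⟪a t, y⟫ - ⟪a t, x⟫) := fun t _ => by
    by_cases ht : t ∈ D
    · have h1 : ⟪a t, y⟫ = b t := hact ht
      exact mul_nonneg (hlam t) (by linarith [hx.1 t])
    · simp [hlam0 t ht]
  have hzero : ∑ t, lam t * (⟪a t, y⟫ - ⟪a t, x⟫) = 0 := by
    simp only [hsum, sum_inner, real_inner_smul_left] at hval
    simp only [mul_sub, Finset.sum_sub_distrib]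
    linarith
  intro t ht
  have h1 := (Finset.sum_eq_zero_iff_of_nonneg hterm).1 hzero t (Finset.mem_univ t)
  have h2 := (mul_eq_zero.1 h1).resolve_left (hpos t ht).ne'
  have h3 : ⟪a t, y⟫ = b t := hact ht
  change ⟪a t, x⟫ = b t
  linarith

theorem LD_eq_Fop (hD : D ∈ Mcb a c b) : LD a D b (fun t => -b t) = Fop a c b := by
  ext x
  constructor
  · rintro ⟨hx, hxD⟩
    have hact : (D : Set (Fin m)) ⊆ activeSet a b x := fun t ht =>
      le_antisymm (hx t) (neg_le_neg_iff.1 (hxD t ht))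
    obtain ⟨-, -, -, hcone, -⟩ := hD
    exact mem_Fop_of_inCone hx hact hcone
  · intro hx
    refine ⟨hx.1, fun t ht => ?_⟩
    have h : ⟪a t, x⟫ = b t := subset_activeSet_of_mem_Mcb hD hx ht
    rw [h]

theorem Mcb_nonempty (hx : x ∈ Fop a c b) : (Mcb a c b).Nonempty := by
  obtain ⟨D, hact, hcone⟩ := exists_inCone_of_mem_Fop hx
  obtain ⟨D', hsub, hcone', hmin⟩ := exists_minimal_inCone hcone
  exact ⟨D', x, hx, fun t ht => hact (hsub ht), hcone', hmin⟩

theorem isClosed_inCone (a : Fin m → EuclideanSpace ℝ (Fin n)) (D : Finset (Fin m)) :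
    IsClosed {z | InCone a D z} := by
  classical
  have : {z | InCone a D z} = finCone fun t => if t ∈ D then a t else 0 := by
    ext z
    constructor
    · rintro ⟨lam, hlam, hlam0, rfl⟩
      refine ⟨lam, hlam, Finset.sum_congr rfl fun t _ => ?_⟩
      by_cases ht : t ∈ D
      · simp [ht]
      · simp [hlam0 t ht]
    · rintro ⟨lam, hlam, rfl⟩
      refine ⟨fun t => if t ∈ D then lam t else 0, fun t => ?_, fun t ht => by simp [ht],
        Finset.sum_congr rfl fun t _ => ?_⟩
      · dsimp only
        split_ifs
        · exact hlam t
        · exact le_rfl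
      · by_cases ht : t ∈ D <;> simp [ht]
  rw [this]
  exact isClosed_finCone _

/-- Finitely many closed cones: those containing points close to `z` contain `z`. -/
theorem eventually_inCone_imp (a : Fin m → EuclideanSpace ℝ (Fin n))
    (z : EuclideanSpace ℝ (Fin n)) :
    ∀ᶠ w in nhds z, ∀ D, InCone a D w → InCone a D z := by
  rw [eventually_all]
  intro D
  by_cases h : InCone a D z
  · exact Eventually.of_forall fun _ _ => h
  · filter_upwards [(isClosed_inCone a D).isOpen_compl.mem_nhds h] with w hw hw'
    exact absurd hw' hw

/-- The gradients of the constraints of `L_D` that are active at `x`. -/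
def activeGradients (a : Fin m → EuclideanSpace ℝ (Fin n)) (b : Fin m → ℝ)
    (x : EuclideanSpace ℝ (Fin n)) (D : Finset (Fin m)) : Set (EuclideanSpace ℝ (Fin n)) :=
  (a '' activeSet a b x) ∪ ((fun t => -(a t)) '' (D : Set (Fin m)))

theorem finite_activeGradients : (activeGradients a b x D).Finite :=
  ((Set.toFinite _).image _).union ((Set.toFinite _).image _)

theorem forall_mem_activeGradients {w : EuclideanSpace ℝ (Fin n)} {ε : ℝ} :
    (∀ v ∈ activeGradients a b x D, ⟪v, w⟫ ≤ ε) ↔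
      (∀ t ∈ activeSet a b x, ⟪a t, w⟫ ≤ ε) ∧ ∀ t ∈ D, -⟪a t, w⟫ ≤ ε := by
  simp [activeGradients, or_imp, forall_and]

/-- Local error bound for the system defining `L_D`. -/
theorem eventually_infEDist_LD_le (hx : x ∈ LD a D b (fun t => -b t)) :
    ∀ᶠ y in nhds x, ∀ ε : ℝ, (∀ t ∈ activeSet a b x, ⟪a t, y⟫ - b t ≤ ε) →
      (∀ t ∈ D, b t - ⟪a t, y⟫ ≤ ε) →
      Metric.infEDist y (LD a D b (fun t => -b t)) ≤
        (Metric.infEDist 0 (endSet (convexHull ℝ (activeGradients a b x D))))⁻¹ *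
          ENNReal.ofReal ε := by
  obtain ⟨ρ, hρ, hball⟩ := Metric.eventually_nhds_iff.1 (eventually_inactive a b x)
  have hact : ∀ t ∈ D, ⟪a t, x⟫ = b t := fun t ht =>
    le_antisymm (hx.1 t) (neg_le_neg_iff.1 (hx.2 t ht))
  filter_upwards [Metric.ball_mem_nhds x hρ] with y hy ε hε1 hε2
  rw [Metric.mem_ball, dist_eq_norm] at hy
  obtain ⟨p, hpK, hpx, hp⟩ := exists_polar_point (finite_activeGradients (a := a) (b := b) (x := x)
    (D := D)) (y - x) (ε := ε) (forall_mem_activeGradients.2 ⟨fun t ht => by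
      have : ⟪a t, x⟫ = b t := ht
      rw [inner_sub_right, this]
      exact hε1 t ht, fun t ht => by
      rw [inner_sub_right, hact t ht]
      linarith [hε2 t ht]⟩)
  rw [forall_mem_activeGradients] at hpK
  have hmem : x + p ∈ LD a D b (fun t => -b t) := by
    refine ⟨fun t => ?_, fun t ht => ?_⟩
    · by_cases ht : ⟪a t, x⟫ = b t
      · rw [inner_add_right, ht]
        linarith [hpK.1 t ht]
      · refine (hball (y := x + p) ?_ t (lt_of_le_of_ne (hx.1 t) ht)).le
        rw [dist_eq_norm, add_sub_cancel_left]
        exact hpx.trans_lt hy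
    · rw [inner_add_right, hact t ht]
      linarith [hpK.2 t ht]
  have hdist : Metric.infEDist y (LD a D b (fun t => -b t)) ≤ ENNReal.ofReal ‖y - x - p‖ := by
    refine (Metric.infEDist_le_edist_of_mem hmem).trans_eq ?_
    rw [edist_dist, dist_eq_norm, sub_sub]
  rcases hp with hp | ⟨u, hu, hu0, hup⟩
  · rw [hp, sub_self, norm_zero, ENNReal.ofReal_zero] at hdist
    exact hdist.trans zero_le
  · refine hdist.trans ((ENNReal.ofReal_le_ofReal hup).trans ?_)
    rw [ENNReal.ofReal_mul (inv_nonneg.2 hu0.le), ENNReal.ofReal_inv_of_pos hu0]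
    gcongr
    refine (Metric.infEDist_le_edist_of_mem hu).trans_eq ?_
    rw [edist_dist, dist_eq_norm, zero_sub, norm_neg]

end LinearProgram

section CalmnessModulus

variable {n m : ℕ} {a : Fin m → EuclideanSpace ℝ (Fin n)} {c x : EuclideanSpace ℝ (Fin n)}
  {b : Fin m → ℝ} {D : Finset (Fin m)}

/-- Each end point of the hull of the active gradients bounds the calmness modulus of `L_D` from
below. -/
theorem ofReal_inv_le_clmMod_LD (hx : x ∈ LD a D b (fun t => -b t))
    {u : EuclideanSpace ℝ (Fin n)} (hu : u ∈ endSet (convexHull ℝ (activeGradients a b x D)))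
    {μ : ℝ} (hμ : 1 < μ) :
    ENNReal.ofReal (μ * ‖u‖)⁻¹ ≤
      clmMod (fun q : (Fin m → ℝ) × (Fin m → ℝ) => LD a D q.1 q.2) (b, fun t => -b t) x := by
  classical
  obtain ⟨w, s, hs, hws, hsw⟩ := exists_direction_of_mem_endSet hu hμ
  have huw : 0 < ⟪u, w⟫ := by
    by_contra h
    nlinarith
  have hu0 : 0 < ‖u‖ := norm_pos_iff.2 fun h => by simp [h] at huw
  rw [forall_mem_activeGradients] at hws
  have hact : ∀ t ∈ D, ⟪a t, x⟫ = b t := fun t ht =>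
    le_antisymm (hx.1 t) (neg_le_neg_iff.1 (hx.2 t ht))
  have huC : u ∈ convexHull ℝ (activeGradients a b x D) := by
    have := hu.1
    rwa [(finite_activeGradients.isClosed_convexHull ℝ).closure_eq] at this
  have hsol : ∀ y ∈ LD a D b (fun t => -b t), ⟪u, y - x⟫ ≤ 0 := fun y hy => by
    refine inner_le_of_mem_convexHull huC (forall_mem_activeGradients.2 ⟨fun t ht => ?_,
      fun t ht => ?_⟩)
    · have : ⟪a t, x⟫ = b t := ht
      rw [inner_sub_right, this]
      linarith [hy.1 t]
    · have := hy.2 t ht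
      rw [inner_sub_right, hact t ht]
      linarith
  have htend : Tendsto (fun τ : ℝ => x + τ • w) (nhdsWithin 0 (Ioi 0)) (nhds x) := by
    have : ContinuousAt (fun τ : ℝ => x + τ • w) 0 := by fun_prop
    simpa [ContinuousAt] using this.tendsto.mono_left nhdsWithin_le_nhds
  refine le_limsup_of_frequently_le' (htend.frequently (Eventually.frequently ?_))
  filter_upwards [htend.eventually (eventually_inactive a b x), self_mem_nhdsWithin] with τ hτ hτ0
  replace hτ0 : 0 < τ := hτ0
  have hnum : ENNReal.ofReal (τ * ⟪u, w⟫ / ‖u‖) ≤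
      Metric.infEDist (x + τ • w) (LD a D b (fun t => -b t)) := by
    refine Metric.le_infEDist.2 fun y hy => ?_
    rw [edist_dist]
    refine ENNReal.ofReal_le_ofReal ?_
    rw [dist_eq_norm, div_le_iff₀ hu0, mul_comm ‖_‖]
    have h1 := real_inner_le_norm u (x + τ • w - y)
    have h2 : ⟪u, x + τ • w - y⟫ = τ * ⟪u, w⟫ - ⟪u, y - x⟫ := by
      simp only [inner_sub_right, inner_add_right, real_inner_smul_right]
      ring
    linarith [hsol y hy]
  have hden : Metric.infEDist ((b, fun t => -b t) : (Fin m → ℝ) × (Fin m → ℝ))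
      {q : (Fin m → ℝ) × (Fin m → ℝ) | x + τ • w ∈ LD a D q.1 q.2} ≤
        ENNReal.ofReal (τ * s) := by
    have hτs : 0 ≤ τ * s := by positivity
    have hmem : ((fun t => max (b t) ⟪a t, x + τ • w⟫,
        fun t => if t ∈ D then max (-b t) (-⟪a t, x + τ • w⟫) else -b t) :
        (Fin m → ℝ) × (Fin m → ℝ)) ∈
        {q : (Fin m → ℝ) × (Fin m → ℝ) | x + τ • w ∈ LD a D q.1 q.2} :=
      ⟨fun t => le_max_right _ _, fun t ht => by simp [ht]⟩
    refine (Metric.infEDist_le_edist_of_mem hmem).trans ?_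
    rw [edist_dist]
    refine ENNReal.ofReal_le_ofReal (max_le ((dist_pi_le_iff hτs).2 fun t => ?_)
      ((dist_pi_le_iff hτs).2 fun t => ?_))
    · have hle : ⟪a t, x + τ • w⟫ ≤ b t + τ * s := by
        by_cases ht : ⟪a t, x⟫ = b t
        · rw [inner_add_right, real_inner_smul_right, ht]
          have := mul_le_mul_of_nonneg_left (hws.1 t ht) hτ0.le
          linarith
        · linarith [hτ t (lt_of_le_of_ne (hx.1 t) ht)]
      rw [dist_comm, Real.dist_eq, abs_of_nonneg (sub_nonneg.2 (le_max_left _ _)),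
        sub_le_iff_le_add']
      exact max_le (le_add_of_nonneg_right hτs) hle
    · dsimp only
      split_ifs with ht
      · have := mul_le_mul_of_nonneg_left (hws.2 t ht) hτ0.le
        rw [dist_comm, Real.dist_eq, abs_of_nonneg (sub_nonneg.2 (le_max_left _ _)),
          sub_le_iff_le_add, inner_add_right, real_inner_smul_right, hact t ht]
        exact max_le (by linarith) (by linarith)
      · rwa [dist_self]
  calc ENNReal.ofReal (μ * ‖u‖)⁻¹
      ≤ ENNReal.ofReal (τ * ⟪u, w⟫ / ‖u‖ / (τ * s)) := by
        refine ENNReal.ofReal_le_ofReal ?_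
        rw [div_div, inv_eq_one_div, div_le_div_iff₀ (by positivity) (by positivity)]
        have := mul_pos hτ0 hu0
        nlinarith
    _ = ENNReal.ofReal (τ * ⟪u, w⟫ / ‖u‖) / ENNReal.ofReal (τ * s) :=
        ENNReal.ofReal_div_of_pos (by positivity)
    _ ≤ _ := ENNReal.div_le_div hnum hden

theorem inv_infEDist_le_clmMod_LD (hx : x ∈ LD a D b (fun t => -b t)) :
    (Metric.infEDist 0 (endSet (convexHull ℝ (activeGradients a b x D))))⁻¹ ≤
      clmMod (fun q : (Fin m → ℝ) × (Fin m → ℝ) => LD a D q.1 q.2) (b, fun t => -b t) x := by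
  rw [ENNReal.inv_le_iff_inv_le, Metric.le_infEDist]
  intro u hu
  rw [ENNReal.inv_le_iff_inv_le]
  have hu0 : 0 < ‖u‖ := norm_pos_iff.2 fun h =>
    hu.2 ⟨2, one_lt_two, by rw [h, smul_zero, ← h]; exact hu.1⟩
  have hedist : (edist 0 u)⁻¹ = ENNReal.ofReal ((1 * ‖u‖)⁻¹) := by
    rw [edist_dist, dist_eq_norm, zero_sub, norm_neg, one_mul, ENNReal.ofReal_inv_of_pos hu0]
  have hcont : Tendsto (fun μ : ℝ => ENNReal.ofReal (μ * ‖u‖)⁻¹) (nhdsWithin 1 (Ioi 1))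
      (nhds (ENNReal.ofReal (1 * ‖u‖)⁻¹)) := by
    refine (ENNReal.tendsto_ofReal ?_).mono_left nhdsWithin_le_nhds
    exact ((continuous_id.mul continuous_const).tendsto 1).inv₀ (by simpa using hu0.ne')
  rw [hedist]
  refine le_of_tendsto hcont ?_
  filter_upwards [self_mem_nhdsWithin] with μ hμ using ofReal_inv_le_clmMod_LD hx hu hμ

theorem clmMod_LD_le (hD : D ∈ Mcb a c b) :
    clmMod (fun q : (Fin m → ℝ) × (Fin m → ℝ) => LD a D q.1 q.2) (b, fun t => -b t) x ≤
      clmMod (fun b => Fop a c b) b x := by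
  classical
  refine limsup_le_limsup (Eventually.of_forall fun y => ?_)
  refine ENNReal.div_le_div (congrArg _ (LD_eq_Fop hD)).le (Metric.le_infEDist.2 fun q hq => ?_)
  have hq : y ∈ LD a D q.1 q.2 := hq
  have hfeas : y ∈ Feas a fun t => if t ∈ D then ⟪a t, y⟫ else max (b t) ⟪a t, y⟫ := fun t => by
    dsimp only
    split_ifs
    · exact le_rfl
    · exact le_max_right _ _
  have hact : (D : Set (Fin m)) ⊆
      activeSet a (fun t => if t ∈ D then ⟪a t, y⟫ else max (b t) ⟪a t, y⟫) y := fun t ht => by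
    simp [activeSet, Finset.mem_coe.1 ht]
  have hmem : (fun t => if t ∈ D then ⟪a t, y⟫ else max (b t) ⟪a t, y⟫) ∈
      {b' | y ∈ Fop a c b'} := by
    obtain ⟨-, -, -, hcone, -⟩ := hD
    exact mem_Fop_of_inCone hfeas hact hcone
  refine (Metric.infEDist_le_edist_of_mem hmem).trans ?_
  rw [edist_dist, edist_dist]
  refine ENNReal.ofReal_le_ofReal ((dist_pi_le_iff dist_nonneg).2 fun t => ?_)
  have h1 : |b t - q.1 t| ≤ dist (b, fun t => -b t) q :=
    (dist_le_pi_dist b q.1 t).trans (le_max_left _ _)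
  have h2 : |-b t - q.2 t| ≤ dist (b, fun t => -b t) q :=
    (dist_le_pi_dist (fun t => -b t) q.2 t).trans (le_max_right _ _)
  rw [abs_le] at h1 h2
  have h3 := hq.1 t
  split_ifs with ht
  · have h4 := hq.2 t ht
    rw [Real.dist_eq, abs_le]
    constructor <;> linarith
  · rw [dist_comm, Real.dist_eq, abs_of_nonneg (sub_nonneg.2 (le_max_left _ _)),
      sub_le_iff_le_add]
    refine max_le ?_ ?_ <;> linarith [dist_nonneg (x := (b, fun t => -b t)) (y := q)]

theorem clmMod_Fop_fixed_cost_le :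
    clmMod (fun b => Fop a c b) b x ≤
      clmMod (fun p : EuclideanSpace ℝ (Fin n) × (Fin m → ℝ) => Fop a p.1 p.2) (c, b) x := by
  refine limsup_le_limsup (Eventually.of_forall fun y => ?_)
  refine ENNReal.div_le_div le_rfl (Metric.le_infEDist.2 fun b' hb' => ?_)
  have hmem : (c, b') ∈ {p : EuclideanSpace ℝ (Fin n) × (Fin m → ℝ) | y ∈ Fop a p.1 p.2} := hb'
  refine (Metric.infEDist_le_edist_of_mem hmem).trans_eq ?_
  simp [Prod.edist_eq]

/-- Constraints that are inactive at `(b, x)` are inactive at nearby points. -/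
theorem eventually_activeSet_subset (a : Fin m → EuclideanSpace ℝ (Fin n)) (b : Fin m → ℝ)
    (x : EuclideanSpace ℝ (Fin n)) :
    ∀ᶠ p in nhds b ×ˢ nhds x, activeSet a p.1 p.2 ⊆ activeSet a b x := by
  have h : ∀ᶠ p : (Fin m → ℝ) × EuclideanSpace ℝ (Fin n) in nhds (b, x),
      ∀ t, ⟪a t, x⟫ ≠ b t → ⟪a t, p.2⟫ ≠ p.1 t := by
    rw [eventually_all]
    intro t
    by_cases ht : ⟪a t, x⟫ = b t
    · exact Eventually.of_forall fun _ h => absurd ht h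
    · have h1 : ContinuousAt
          (fun p : (Fin m → ℝ) × EuclideanSpace ℝ (Fin n) => ⟪a t, p.2⟫ - p.1 t) (b, x) := by
        fun_prop
      filter_upwards [h1.eventually_ne (sub_ne_zero.2 ht)] with p hp _ using sub_ne_zero.1 hp
  rw [← nhds_prod_eq]
  filter_upwards [h] with p hp t ht
  by_contra hne
  exact hp t hne ht

/-- The calmness modulus under full perturbations is controlled by the local error bounds of the
systems `L_D`. -/
theorem clmMod_Fop_le (hx : x ∈ Fop a c b) :
    clmMod (fun p : EuclideanSpace ℝ (Fin n) × (Fin m → ℝ) => Fop a p.1 p.2) (c, b) x ≤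
      ⨆ D ∈ Mcb a c b,
        (Metric.infEDist 0 (endSet (convexHull ℝ (activeGradients a b x D))))⁻¹ := by
  set κ := ⨆ D ∈ Mcb a c b,
    (Metric.infEDist 0 (endSet (convexHull ℝ (activeGradients a b x D))))⁻¹ with hκ
  by_cases hκtop : κ = ⊤
  · rw [hκtop]
    exact le_top
  have heb : ∀ᶠ y in nhds x, ∀ D, D ∈ Mcb a c b → ∀ ε : ℝ,
      (∀ t ∈ activeSet a b x, |⟪a t, y⟫ - b t| ≤ ε) ∨
        ((∀ t, ⟪a t, y⟫ - b t ≤ ε) ∧ ∀ t ∈ D, b t - ⟪a t, y⟫ ≤ ε) →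
      Metric.infEDist y (Fop a c b) ≤ κ * ENNReal.ofReal ε := by
    rw [eventually_all]
    intro D
    by_cases hD : D ∈ Mcb a c b
    · filter_upwards [eventually_infEDist_LD_le (LD_eq_Fop hD ▸ hx)] with y hy _ ε hε
      rw [LD_eq_Fop hD] at hy
      have hle : (Metric.infEDist 0 (endSet (convexHull ℝ (activeGradients a b x D))))⁻¹ ≤ κ :=
        le_iSup₂_of_le D hD le_rfl
      refine (hy ε ?_ ?_).trans (by gcongr)
      · exact fun t ht => hε.elim (fun h => (abs_le.1 (h t ht)).2) fun h => h.1 t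
      · refine fun t ht => hε.elim (fun h => ?_) fun h => h.2 t ht
        linarith [(abs_le.1 (h t (subset_activeSet_of_mem_Mcb hD hx ht))).1]
    · exact Eventually.of_forall fun _ h => absurd h hD
  obtain ⟨D₀, hD₀⟩ := Mcb_nonempty hx
  obtain ⟨r₁, hr₁, hcone⟩ := Metric.eventually_nhds_iff.1 (eventually_inCone_imp a (-c))
  obtain ⟨P, hP, Q, hQ, hPQ⟩ := eventually_prod_iff.1 (eventually_activeSet_subset a b x)
  obtain ⟨r₂, hr₂, hP⟩ := Metric.eventually_nhds_iff.1 hP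
  have hr : 0 < min r₁ r₂ := lt_min hr₁ hr₂
  have hsmall : ∀ᶠ y in nhds x, ∀ t, t ∈ activeSet a b x → |⟪a t, y⟫ - b t| ≤ min r₁ r₂ := by
    rw [eventually_all]
    intro t
    by_cases ht : t ∈ activeSet a b x
    · have h1 : ContinuousAt (fun y => |⟪a t, y⟫ - b t|) x := by fun_prop
      have h2 : |⟪a t, x⟫ - b t| < min r₁ r₂ := by
        rwa [show ⟪a t, x⟫ = b t from ht, sub_self, abs_zero]
      filter_upwards [h1.eventually_lt continuousAt_const h2] with y hy _ using hy.le
    · exact Eventually.of_forall fun _ h => absurd h ht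
  refine limsup_le_of_le (h := ?_)
  filter_upwards [heb, hQ, hsmall] with y hyeb hyQ hysmall
  have hpt : ∀ p ∈ {p : EuclideanSpace ℝ (Fin n) × (Fin m → ℝ) | y ∈ Fop a p.1 p.2},
      Metric.infEDist y (Fop a c b) ≤ κ * edist (c, b) p := by
    rintro ⟨c', b'⟩ hp
    have hp : y ∈ Fop a c' b' := hp
    rw [edist_dist]
    by_cases hfar : min r₁ r₂ ≤ dist (c, b) (c', b')
    · exact hyeb D₀ hD₀ _ (Or.inl fun t ht => (hysmall t ht).trans hfar)
    rw [not_le, lt_min_iff] at hfar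
    have hc : dist c c' ≤ dist (c, b) (c', b') := le_max_left _ _
    have hb : dist b b' ≤ dist (c, b) (c', b') := le_max_right _ _
    obtain ⟨D', hD'act, hD'cone⟩ := exists_inCone_of_mem_Fop hp
    have hD'c : InCone a D' (-c) := by
      refine hcone (y := -c') ?_ D' hD'cone
      rw [dist_neg_neg, dist_comm]
      exact hc.trans_lt hfar.1
    obtain ⟨D, hsub, hDc, hmin⟩ := exists_minimal_inCone hD'c
    have hDact : (D : Set (Fin m)) ⊆ activeSet a b' y := fun t ht => hD'act (hsub ht)
    have hact : activeSet a b' y ⊆ activeSet a b x :=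
      hPQ (hP (by rw [dist_comm]; exact hb.trans_lt hfar.2)) hyQ
    have hD : D ∈ Mcb a c b := ⟨x, hx, hDact.trans hact, hDc, hmin⟩
    have hbt : ∀ t, |b t - b' t| ≤ dist (c, b) (c', b') := fun t =>
      (dist_le_pi_dist b b' t).trans hb
    refine hyeb D hD _ (Or.inr ⟨fun t => ?_, fun t ht => ?_⟩)
    · linarith [hp.1 t, (abs_le.1 (hbt t)).1]
    · have h1 : ⟪a t, y⟫ = b' t := hDact ht
      linarith [(abs_le.1 (hbt t)).2]
  change Metric.infEDist y (Fop a c b) / Metric.infEDist (c, b)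
    {p : EuclideanSpace ℝ (Fin n) × (Fin m → ℝ) | y ∈ Fop a p.1 p.2} ≤ κ
  by_cases hκ0 : κ = 0
  · have := hyeb D₀ hD₀ _ (Or.inl hysmall)
    rw [hκ0, zero_mul, nonpos_iff_eq_zero] at this
    rw [this, ENNReal.zero_div]
    exact zero_le
  · refine ENNReal.div_le_of_le_mul ?_
    rw [← ENNReal.div_le_iff' hκ0 hκtop]
    exact Metric.le_infEDist.2 fun p hp => (ENNReal.div_le_iff' hκ0 hκtop).2 (hpt p hp)

end CalmnessModulus

/-- Let `((c̄,b̄),x̄) ∈ gph F^op`. Then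
`clm F^op((c̄,b̄),x̄) = clm F_c̄^op(b̄,x̄) = max_{D ∈ M_{c̄,b̄}} clm L_D((b̄,−b̄_D),x̄)
= (min_{D ∈ M_{c̄,b̄}} d_*(0, end conv{a_t, t ∈ T_b̄(x̄); −a_t, t ∈ D}))⁻¹`. -/
theorem clm_Fop_eq {n m : ℕ} (a : Fin m → EuclideanSpace ℝ (Fin n))
    (cbar : EuclideanSpace ℝ (Fin n)) (bbar : Fin m → ℝ)
    (xbar : EuclideanSpace ℝ (Fin n)) (hx : xbar ∈ Fop a cbar bbar) :
    clmMod (fun p : EuclideanSpace ℝ (Fin n) × (Fin m → ℝ) => Fop a p.1 p.2) (cbar, bbar) xbar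
        = clmMod (fun b => Fop a cbar b) bbar xbar ∧
    clmMod (fun p : EuclideanSpace ℝ (Fin n) × (Fin m → ℝ) => Fop a p.1 p.2) (cbar, bbar) xbar
        = (⨆ D ∈ Mcb a cbar bbar,
            clmMod (fun q : (Fin m → ℝ) × (Fin m → ℝ) => LD a D q.1 q.2)
              (bbar, fun t => -(bbar t)) xbar) ∧
    clmMod (fun p : EuclideanSpace ℝ (Fin n) × (Fin m → ℝ) => Fop a p.1 p.2) (cbar, bbar) xbar
        = (⨅ D ∈ Mcb a cbar bbar,
            EMetric.infEdist (0 : EuclideanSpace ℝ (Fin n))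
              (endSet (convexHull ℝ
                ((a '' activeSet a bbar xbar) ∪ ((fun t => -(a t)) '' (D : Set (Fin m)))))))⁻¹ := by
  have hAB : clmMod (fun b => Fop a cbar b) bbar xbar ≤ _ := clmMod_Fop_fixed_cost_le
  have hLB : (⨆ D ∈ Mcb a cbar bbar,
      clmMod (fun q : (Fin m → ℝ) × (Fin m → ℝ) => LD a D q.1 q.2)
        (bbar, fun t => -(bbar t)) xbar) ≤ clmMod (fun b => Fop a cbar b) bbar xbar :=
    iSup₂_le fun D hD => clmMod_LD_le hD
  have hEL : (⨆ D ∈ Mcb a cbar bbar,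
      (Metric.infEDist 0 (endSet (convexHull ℝ (activeGradients a bbar xbar D))))⁻¹) ≤
      ⨆ D ∈ Mcb a cbar bbar,
        clmMod (fun q : (Fin m → ℝ) × (Fin m → ℝ) => LD a D q.1 q.2)
          (bbar, fun t => -(bbar t)) xbar :=
    iSup₂_mono fun D hD => inv_infEDist_le_clmMod_LD (LD_eq_Fop hD ▸ hx)
  have hE := clmMod_Fop_le hx
  refine ⟨le_antisymm (hE.trans (hEL.trans hLB)) hAB,
    le_antisymm (hE.trans hEL) (hLB.trans hAB), ?_⟩
  simp only [ENNReal.inv_iInf]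
  exact le_antisymm hE (hEL.trans (hLB.trans hAB))
end

section
/- Let S = ⋃_{i∈I} S_i be a well-connected polyhedral mapping. Then for every pair b, b̄ ∈ dom S there exist a subdivision 0 = μ_0 < μ_1 < … < μ_N = 1 together with a family of indices i_1,…,i_N ∈ I connecting b with b̄, i.e. such that for all k ∈ {1,…,N} and all μ ∈ [μ_{k-1},μ_k], b̄ + μ(b − b̄) ∈ dom S_{i_k}. -/
open Set

/-- A convex polyhedral subset: a finite intersection of closed half-spaces. -/
def IsPolyhedral {E : Type*} [NormedAddCommGroup E] [NormedSpace ℝ E] (C : Set E) : Prop :=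
  ∃ (k : ℕ) (f : Fin k → E →L[ℝ] ℝ) (c : Fin k → ℝ), C = {x | ∀ i, f i x ≤ c i}

/-- `S = ⋃_{i ∈ I} S_i` is a well-connected polyhedral mapping. -/
structure IsWellConnectedPolyhedral {Y X I : Type*}
    [NormedAddCommGroup Y] [NormedSpace ℝ Y] [NormedAddCommGroup X] [NormedSpace ℝ X]
    [Finite I] (S : Y → Set X) (Si : I → Y → Set X) : Prop where
  graph_nonempty : ∀ i, {p : Y × X | p.2 ∈ Si i p.1}.Nonempty
  graph_polyhedral : ∀ i, IsPolyhedral {p : Y × X | p.2 ∈ Si i p.1}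
  union : ∀ b, S b = ⋃ i, Si i b
  dom_convex : Convex ℝ {b | (S b).Nonempty}
  restrict : ∀ i b, (Si i b).Nonempty → S b = Si i b

/-- A finite system of affine inequalities indexed by any finite type is polyhedral. -/
theorem IsPolyhedral.of_finite {E ι : Type*} [NormedAddCommGroup E] [NormedSpace ℝ E] [Finite ι]
    (f : ι → E →L[ℝ] ℝ) (c : ι → ℝ) : IsPolyhedral {x | ∀ i, f i x ≤ c i} := by
  obtain ⟨n, ⟨e⟩⟩ := Finite.exists_equiv_fin ι
  refine ⟨n, fun i => f (e.symm i), fun i => c (e.symm i), ?_⟩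
  ext x
  exact (e.symm.forall_congr_right (q := fun i => f i x ≤ c i)).symm

theorem IsPolyhedral.isClosed {E : Type*} [NormedAddCommGroup E] [NormedSpace ℝ E] {P : Set E}
    (hP : IsPolyhedral P) : IsClosed P := by
  obtain ⟨k, f, c, rfl⟩ := hP
  simp only [ofPred_forall]
  exact isClosed_iInter fun i => isClosed_le (f i).continuous continuous_const

theorem IsPolyhedral.convex {E : Type*} [NormedAddCommGroup E] [NormedSpace ℝ E] {P : Set E}
    (hP : IsPolyhedral P) : Convex ℝ P := by
  obtain ⟨k, f, c, rfl⟩ := hP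
  simp only [ofPred_forall]
  exact convex_iInter fun i => convex_halfSpace_le (f i).isLinear (c i)

theorem exists_between_of_finite {ι κ : Type*} [Finite ι] [Finite κ] (L : ι → ℝ) (U : κ → ℝ)
    (h : ∀ i j, L i ≤ U j) : ∃ s, (∀ i, L i ≤ s) ∧ ∀ j, s ≤ U j := by
  rcases isEmpty_or_nonempty ι with hι | hι
  · obtain ⟨s, hs⟩ := (finite_range U).bddBelow
    exact ⟨s, fun i => hι.elim i, fun j => hs (mem_range_self j)⟩
  · obtain ⟨i, hi⟩ := Finite.exists_max L
    exact ⟨L i, hi, h i⟩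

/-- Fourier–Motzkin elimination along a direction `v`. -/
theorem IsPolyhedral.exists_add_smul_mem {E : Type*} [NormedAddCommGroup E] [NormedSpace ℝ E]
    {P : Set E} (hP : IsPolyhedral P) (v : E) : IsPolyhedral {y | ∃ s : ℝ, y + s • v ∈ P} := by
  obtain ⟨k, f, c, rfl⟩ := hP
  convert IsPolyhedral.of_finite
    (ι := {i // f i v = 0} ⊕ {i // f i v < 0} × {i // 0 < f i v})
    (Sum.elim (fun i => f i) (fun p => f p.2 v • f p.1 - f p.1 v • f p.2))
    (Sum.elim (fun i => c i) (fun p => f p.2 v * c p.1 - f p.1 v * c p.2)) using 1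
  ext y
  simp only [mem_ofPred_eq, map_add, map_smul, smul_eq_mul, Sum.forall, Sum.elim_inl, Sum.elim_inr,
    Prod.forall, sub_apply, smul_apply]
  constructor
  · rintro ⟨s, hs⟩
    refine ⟨fun i => by simpa [i.2] using hs i, fun i j => ?_⟩
    nlinarith [mul_le_mul_of_nonneg_left (hs i) j.2.le, mul_le_mul_of_nonpos_left (hs j) i.2.le]
  · rintro ⟨h0, h1⟩
    obtain ⟨s, hL, hU⟩ := exists_between_of_finite
      (fun i : {i // f i v < 0} => (c i - f i y) / f i v)
      (fun i : {i // 0 < f i v} => (c i - f i y) / f i v) (fun i j => by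
        rw [div_le_iff_of_neg i.2, div_mul_eq_mul_div, div_le_iff₀ j.2]
        linarith [h1 i j])
    refine ⟨s, fun i => ?_⟩
    rcases lt_trichotomy (f i v) 0 with hi | hi | hi
    · have := (div_le_iff_of_neg hi).1 (hL ⟨i, hi⟩)
      linarith
    · simpa [hi] using h0 ⟨i, hi⟩
    · have := (le_div_iff₀ hi).1 (hU ⟨i, hi⟩)
      linarith

theorem IsPolyhedral.exists_add_mem_of_fg {E : Type*} [NormedAddCommGroup E] [NormedSpace ℝ E]
    {W : Submodule ℝ E} (hW : W.FG) {P : Set E} (hP : IsPolyhedral P) :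
    IsPolyhedral {y | ∃ w ∈ W, y + w ∈ P} := by
  induction W, hW using Submodule.fg_induction generalizing P with
  | singleton v =>
    simpa [Submodule.mem_span_singleton] using hP.exists_add_smul_mem v
  | sup W₁ W₂ _ _ h₁ h₂ =>
    convert h₁ (h₂ hP) using 1
    ext y
    constructor
    · rintro ⟨w, hw, hy⟩
      obtain ⟨u, hu, v, hv, rfl⟩ := Submodule.mem_sup.1 hw
      exact ⟨u, hu, v, hv, by rwa [add_assoc]⟩
    · rintro ⟨u, hu, v, hv, hy⟩
      exact ⟨u + v, Submodule.add_mem_sup hu hv, by rwa [← add_assoc]⟩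

theorem IsPolyhedral.exists_add_mem {E : Type*} [NormedAddCommGroup E] [NormedSpace ℝ E]
    (W : Submodule ℝ E) {P : Set E} (hP : IsPolyhedral P) :
    IsPolyhedral {y | ∃ w ∈ W, y + w ∈ P} := by
  obtain ⟨k, f, c, rfl⟩ := id hP
  let φ : E →ₗ[ℝ] Fin k → ℝ := LinearMap.pi fun i => (f i : E →ₗ[ℝ] ℝ)
  obtain ⟨V, hVW, hV, hmap⟩ : ∃ V ≤ W, V.FG ∧ V.map φ = W.map φ := by
    obtain ⟨s, hs⟩ := IsNoetherian.noetherian (W.map φ)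
    have hsub : (s : Set (Fin k → ℝ)) ⊆ φ '' W := fun x hx => by
      have : x ∈ W.map φ := hs ▸ Submodule.subset_span hx
      simpa using this
    classical
    obtain ⟨t, htW, rfl⟩ := Finset.subset_set_image_iff.1 hsub
    refine ⟨Submodule.span ℝ t, Submodule.span_le.2 htW, ⟨t, rfl⟩, ?_⟩
    rw [Submodule.map_span, ← hs, Finset.coe_image]
  convert hP.exists_add_mem_of_fg hV using 1
  ext y
  constructor
  · rintro ⟨w, hw, hy⟩
    obtain ⟨v, hv, hvw⟩ : φ w ∈ V.map φ := hmap ▸ Submodule.mem_map_of_mem hw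
    refine ⟨v, hv, fun i => ?_⟩
    have hi : f i v = f i w := congrFun hvw i
    simpa [hi] using hy i
  · rintro ⟨w, hw, hy⟩
    exact ⟨w, hVW hw, hy⟩

theorem IsPolyhedral.preimage {E F : Type*} [NormedAddCommGroup E] [NormedSpace ℝ E]
    [NormedAddCommGroup F] [NormedSpace ℝ F] {P : Set F} (hP : IsPolyhedral P)
    (A : E →L[ℝ] F) (a : F) : IsPolyhedral {x | a + A x ∈ P} := by
  obtain ⟨k, f, c, rfl⟩ := hP
  refine ⟨k, fun i => (f i).comp A, fun i => c i - f i a, ?_⟩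
  ext x
  simp [le_sub_iff_add_le']

/-- The domain of a mapping with polyhedral graph is polyhedral. -/
theorem IsPolyhedral.dom {Y X : Type*} [NormedAddCommGroup Y] [NormedSpace ℝ Y]
    [NormedAddCommGroup X] [NormedSpace ℝ X] {T : Y → Set X}
    (hT : IsPolyhedral {p : Y × X | p.2 ∈ T p.1}) : IsPolyhedral {y | (T y).Nonempty} := by
  convert (hT.exists_add_mem (LinearMap.range (LinearMap.inr ℝ Y X))).preimage
    (ContinuousLinearMap.inl ℝ Y X) 0 using 1
  ext y
  simp [Set.Nonempty]

/-- If finitely many closed sets cover points accumulating at `t`, one of them contains `t` as well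
as points of the accumulation filter. -/
theorem exists_mem_and_frequently_of_finite_cover {I α : Type*} [Finite I] [TopologicalSpace α]
    {T : I → Set α} (hT : ∀ i, IsClosed (T i)) {t : α} {l : Filter α} [l.NeBot]
    (hl : l ≤ nhds t) (h : ∀ᶠ s in l, ∃ i, s ∈ T i) : ∃ i, t ∈ T i ∧ ∃ᶠ s in l, s ∈ T i := by
  obtain ⟨i, hi⟩ : ∃ i, ∃ᶠ s in l, s ∈ T i := by
    by_contra! hcon
    have hall : ∀ᶠ s in l, ∀ i, s ∉ T i :=
      Filter.eventually_all.2 hcon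
    obtain ⟨s, ⟨i, hs⟩, hs'⟩ := (h.and hall).exists
    exact hs' i hs
  exact ⟨i, (hT i).closure_subset (mem_closure_iff_frequently.2 (hi.filter_mono hl)), hi⟩

/-- A finite cover of an interval by closed convex sets admits a subordinate subdivision. -/
theorem exists_subdivision_of_closed_convex_cover {I : Type*} [Finite I] {T : I → Set ℝ}
    (hcl : ∀ i, IsClosed (T i)) (hcv : ∀ i, Convex ℝ (T i)) {a b : ℝ} (hab : a ≤ b)
    (hcov : ∀ t ∈ Icc a b, ∃ i, t ∈ T i) :
    ∃ (N : ℕ) (μ : ℕ → ℝ) (idx : ℕ → I), μ 0 = a ∧ μ N = b ∧ (∀ k < N, μ k < μ (k + 1)) ∧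
      ∀ k, 1 ≤ k → k ≤ N → Icc (μ (k - 1)) (μ k) ⊆ T (idx k) := by
  let R : ℝ → Prop := fun t => ∃ (N : ℕ) (μ : ℕ → ℝ) (idx : ℕ → I),
    μ 0 = a ∧ μ N = t ∧ (∀ k < N, μ k < μ (k + 1)) ∧
      ∀ k, 1 ≤ k → k ≤ N → Icc (μ (k - 1)) (μ k) ⊆ T (idx k)
  have hext : ∀ r t i, R r → r < t → r ∈ T i → t ∈ T i → R t := by
    rintro r t i ⟨N, μ, idx, h0, rfl, hlt, hsub⟩ hrt hr ht
    refine ⟨N + 1, Function.update μ (N + 1) t, Function.update idx (N + 1) i, by simpa,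
      by simp, fun k hk => ?_, fun k hk1 hk => ?_⟩
    · rw [Function.update_of_ne hk.ne]
      rcases (Nat.lt_succ_iff.1 hk).eq_or_lt with rfl | hk'
      · simpa
      · rw [Function.update_of_ne (by omega)]
        exact hlt k hk'
    · rw [Function.update_of_ne (show k - 1 ≠ N + 1 by omega)]
      rcases hk.eq_or_lt with rfl | hk'
      · simpa using (hcv i).ordConnected.out hr ht
      · rw [Function.update_of_ne hk'.ne, Function.update_of_ne hk'.ne]
        exact hsub k hk1 (by omega)
  obtain ⟨i₀, -⟩ := hcov a ⟨le_rfl, hab⟩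
  have hRa : R a := ⟨0, fun _ => a, fun _ => i₀, rfl, rfl, by simp, by intros; omega⟩
  set A : Set ℝ := {t | t ∈ Icc a b ∧ R t}
  have haA : a ∈ A := ⟨⟨le_rfl, hab⟩, hRa⟩
  have hbdd : BddAbove A := ⟨b, fun t ht => ht.1.2⟩
  have hlub := isLUB_csSup ⟨a, haA⟩ hbdd
  set s := sSup A
  have has : a ≤ s := hlub.1 haA
  have hsb : s ≤ b := hlub.2 fun t ht => ht.1.2
  have hRs : R s := by
    rcases has.eq_or_lt with h | h
    · rwa [← h]
    obtain ⟨i, hi, hfr⟩ := exists_mem_and_frequently_of_finite_cover hcl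
      (l := nhdsWithin s (Iio s)) nhdsWithin_le_nhds (by
        filter_upwards [Ioo_mem_nhdsLT h] with t ht
        exact hcov t ⟨ht.1.le, ht.2.le.trans hsb⟩)
    obtain ⟨u, hu, hus⟩ := (hfr.and_eventually self_mem_nhdsWithin).exists
    obtain ⟨r, hrA, hur, hrs⟩ := hlub.exists_between hus
    rcases hrs.eq_or_lt with rfl | hrs
    · exact hrA.2
    · exact hext r s i hrA.2 hrs ((hcv i).ordConnected.out hu hi ⟨hur.le, hrs.le⟩) hi
  rcases hsb.eq_or_lt with h | h
  · rwa [← h]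
  obtain ⟨i, hi, hfr⟩ := exists_mem_and_frequently_of_finite_cover hcl
    (l := nhdsWithin s (Ioi s)) nhdsWithin_le_nhds (by
      filter_upwards [Ioo_mem_nhdsGT h] with t ht
      exact hcov t ⟨has.trans ht.1.le, ht.2.le⟩)
  obtain ⟨u, hu, hsu, hub⟩ := (hfr.and_eventually (Ioo_mem_nhdsGT h)).exists
  have huA : u ∈ A := ⟨⟨has.trans hsu.le, hub.le⟩, hext s u i hRs hsu hi hu⟩
  exact absurd (hlub.1 huA) hsu.not_ge

/-- Let `S = ⋃_{i∈I} S_i` be a well-connected polyhedral mapping. For every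
pair `b, b̄ ∈ dom S` there exist a subdivision `0 = μ_0 < μ_1 < … < μ_N = 1` and indices
`i_1, …, i_N ∈ I` connecting `b` with `b̄`: for all `k ∈ {1,…,N}` and all
`μ ∈ [μ_{k−1}, μ_k]`, `b̄ + μ(b − b̄) ∈ dom S_{i_k}`. -/
theorem exists_subdivision_connecting {Y X I : Type*}
    [NormedAddCommGroup Y] [NormedSpace ℝ Y] [NormedAddCommGroup X] [NormedSpace ℝ X]
    [Finite I] (S : Y → Set X) (Si : I → Y → Set X)
    (hS : IsWellConnectedPolyhedral S Si)
    (b bbar : Y) (hb : (S b).Nonempty) (hbbar : (S bbar).Nonempty) :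
    ∃ (N : ℕ) (μ : ℕ → ℝ) (idx : ℕ → I),
      0 < N ∧ μ 0 = 0 ∧ μ N = 1 ∧ (∀ k < N, μ k < μ (k + 1)) ∧
      ∀ k, 1 ≤ k → k ≤ N → ∀ t ∈ Set.Icc (μ (k - 1)) (μ k),
        (Si (idx k) (bbar + t • (b - bbar))).Nonempty := by
  have hT : ∀ i, IsPolyhedral {t : ℝ | (Si i (bbar + t • (b - bbar))).Nonempty} := fun i =>
    (hS.graph_polyhedral i).dom.preimage
      (ContinuousLinearMap.toSpanSingleton ℝ (b - bbar)) bbar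
  obtain ⟨N, μ, idx, h0, h1, hlt, hsub⟩ := exists_subdivision_of_closed_convex_cover
    (fun i => (hT i).isClosed) (fun i => (hT i).convex) zero_le_one (fun t ht => by
      obtain ⟨x, hx⟩ := hS.dom_convex.add_smul_sub_mem hbbar hb ht
      rw [hS.union, mem_iUnion] at hx
      exact hx.imp fun i hi => ⟨x, hi⟩)
  refine ⟨N, μ, idx, Nat.pos_of_ne_zero ?_, h0, h1, hlt, fun k hk hkN t ht => hsub k hk hkN ht⟩
  rintro rfl
  exact zero_ne_one (h0.symm.trans h1)
end
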